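/- arXiv:0711.0194 — 5 statements merged into one kernel-verified Lean document; each statement's English description precedes it below -/
import Mathlib

section
/- Metric coinduction principle: let (V, d) be a complete metric space, let φ ⊆ V be a nonempty closed subset, and let τ : V → V be a continuous map that is eventually contractive (τ^n is contractive for some n ≥ 1) and satisfies τ(φ) ⊆ φ. Then the unique fixed point u* of τ belongs to φ. -/
/-- metric coinduction: if `φ` is a nonempty closed subset of a complete
metric space `V` and `τ : V → V` is a continuous eventually contractive map with
`τ(φ) ⊆ φ`, then the unique fixed point `u*` of `τ` belongs to `φ`. -/
theorem metric_coinduction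
    {V : Type*} [MetricSpace V] [CompleteSpace V]
    (τ : V → V) (hτ : Continuous τ)
    (n : ℕ) (hn : 1 ≤ n) (c : ℝ) (hc : c < 1)
    (hcontr : ∀ u v : V, dist (τ^[n] u) (τ^[n] v) ≤ c * dist u v)
    (φ : Set V) (hne : φ.Nonempty) (hcl : IsClosed φ)
    (hpres : Set.MapsTo τ φ φ)
    (ustar : V) (hfix : τ ustar = ustar) :
    ustar ∈ φ := by
  obtain ⟨x, hx⟩ := hne
  have : Nonempty V := ⟨x⟩
  have hK : ContractingWith c.toNNReal τ^[n] := by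
    refine ⟨Real.toNNReal_lt_one.2 hc, LipschitzWith.of_dist_le_mul fun u v => ?_⟩
    exact (hcontr u v).trans
      (mul_le_mul_of_nonneg_right (Real.le_coe_toNNReal c) dist_nonneg)
  have hfix' : Function.IsFixedPt τ^[n] ustar := Function.IsFixedPt.iterate hfix n
  rw [hK.fixedPoint_unique hfix']
  exact hcl.mem_of_tendsto (hK.tendsto_iterate_fixedPoint x)
    (Filter.Eventually.of_forall fun k => (hpres.iterate n).iterate k hx)
end

section
/- Let 0 < p ≤ 1/2. The function H*(q) = q is the unique bounded function H : [0,1] → ℝ satisfying the recurrence H(q) = p·H(q/p) for q ≤ p and H(q) = p + (1 − p)·H((q − p)/(1 − p)) for q > p. -/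
/-- `H` is bounded on the unit interval. -/
def BddOnUnit (H : ℝ → ℝ) : Prop :=
  ∃ C : ℝ, ∀ q ∈ Set.Icc (0:ℝ) 1, |H q| ≤ C

/-- `H` satisfies the recurrence `H(q) = p·H(q/p)` for `q ≤ p` and
`H(q) = p + (1-p)·H((q-p)/(1-p))` for `q > p`, on the unit interval. -/
def QflipHeadsRec (p : ℝ) (H : ℝ → ℝ) : Prop :=
  ∀ q ∈ Set.Icc (0:ℝ) 1,
    (q ≤ p → H q = p * H (q / p)) ∧
    (p < q → H q = p + (1 - p) * H ((q - p) / (1 - p)))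

/-- A bounded solution that is within `C` of the identity is within `(1 - p) ^ n * C` of it. -/
lemma QflipHeadsRec.abs_sub_le {p : ℝ} (hp : 0 < p) (hp' : p ≤ 1 / 2) {H : ℝ → ℝ}
    (hH : QflipHeadsRec p H) {C : ℝ} (hC : ∀ q ∈ Set.Icc (0:ℝ) 1, |H q - q| ≤ C) (n : ℕ) :
    ∀ q ∈ Set.Icc (0:ℝ) 1, |H q - q| ≤ (1 - p) ^ n * C := by
  have hp1 : 0 < 1 - p := by linarith
  induction n with
  | zero => simpa using hC
  | succ n ih =>
    intro q hq
    rw [pow_succ', mul_assoc]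
    rcases le_or_gt q p with h | h
    · have hmem : q / p ∈ Set.Icc (0:ℝ) 1 := ⟨div_nonneg hq.1 hp.le, (div_le_one hp).2 h⟩
      have heq : H q - q = p * (H (q / p) - q / p) := by
        rw [(hH q hq).1 h, mul_sub, mul_div_cancel₀ q hp.ne']
      rw [heq, abs_mul, abs_of_pos hp]
      exact mul_le_mul (by linarith) (ih _ hmem) (abs_nonneg _) hp1.le
    · have hmem : (q - p) / (1 - p) ∈ Set.Icc (0:ℝ) 1 :=
        ⟨div_nonneg (by linarith) hp1.le, (div_le_one hp1).2 (by linarith [hq.2])⟩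
      have heq : H q - q = (1 - p) * (H ((q - p) / (1 - p)) - (q - p) / (1 - p)) := by
        rw [(hH q hq).2 h, mul_sub, mul_div_cancel₀ (q - p) hp1.ne']
        ring
      rw [heq, abs_mul, abs_of_pos hp1]
      exact mul_le_mul_of_nonneg_left (ih _ hmem) hp1.le

/-- `H*(q) = q` is the unique bounded function on `[0,1]` satisfying the
heads-probability recurrence. -/
theorem qflip_heads_unique_bounded_solution (p : ℝ) (hp : 0 < p) (hp' : p ≤ 1 / 2) :
    (BddOnUnit (fun q => q) ∧ QflipHeadsRec p (fun q => q)) ∧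
    ∀ H : ℝ → ℝ, BddOnUnit H → QflipHeadsRec p H → ∀ q ∈ Set.Icc (0:ℝ) 1, H q = q := by
  have hp1 : 0 < 1 - p := by linarith
  refine ⟨⟨⟨1, fun q hq => abs_le.2 ⟨by linarith [hq.1], hq.2⟩⟩, fun q _ => ⟨fun _ => ?_, fun _ => ?_⟩⟩,
    fun H ⟨C, hC⟩ hH q hq => ?_⟩
  · exact (mul_div_cancel₀ q hp.ne').symm
  · simp only [mul_div_cancel₀ (q - p) hp1.ne', add_sub_cancel]
  · have hbound : ∀ x ∈ Set.Icc (0:ℝ) 1, |H x - x| ≤ C + 1 := fun x hx =>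
      (abs_sub _ _).trans (add_le_add (hC x hx) (abs_le.2 ⟨by linarith [hx.1], hx.2⟩))
    have hlim : Filter.Tendsto (fun n : ℕ => (1 - p) ^ n * (C + 1)) Filter.atTop (nhds 0) := by
      simpa using (tendsto_pow_atTop_nhds_zero_of_lt_one hp1.le (by linarith)).mul_const (C + 1)
    have hle : |H q - q| ≤ 0 :=
      ge_of_tendsto' hlim fun n => hH.abs_sub_le hp hp' hbound n q hq
    exact sub_eq_zero.1 (abs_nonpos_iff.1 hle)
end

section
/- Let 0 < p ≤ 1/2. For every q ∈ [0,1], the series E₁*(q) = Σ_{n=0}^∞ Π_{j=0}^{n−1} r(f₁^j(q)) converges, E₁* is bounded on [0,1] by 1/p, and E₁* satisfies the recurrence E₁*(q) = 1 + r(q)·E₁*(f₁(q)) for all q ∈ [0,1]. -/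
noncomputable section

/-- The rescaling map `f₁` of the modified Qflip procedure. -/
def f1 (p q : ℝ) : ℝ :=
  if q ≤ p then q / p
  else if q < 1 - p then (q - p) / (1 - p)
  else (q - (1 - p)) / p

/-- The continuation probability `r`. -/
def r (p q : ℝ) : ℝ := if p < q ∧ q < 1 - p then 1 - p else p

/-- `E₁*(q) = Σ_{n=0}^∞ Π_{j=0}^{n-1} r(f₁^j(q))`. -/
def E1star (p q : ℝ) : ℝ := ∑' n : ℕ, ∏ j ∈ Finset.range n, r p ((f1 p)^[j] q)

theorem r_nonneg {p : ℝ} (hp : 0 ≤ p) (q : ℝ) : 0 ≤ r p q := by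
  unfold r
  split_ifs <;> linarith

theorem r_le_one_sub {p : ℝ} (hp' : p ≤ 1 / 2) (q : ℝ) : r p q ≤ 1 - p := by
  unfold r
  split_ifs <;> linarith

theorem prod_r_nonneg {p : ℝ} (hp : 0 ≤ p) (q : ℝ) (n : ℕ) :
    0 ≤ ∏ j ∈ Finset.range n, r p ((f1 p)^[j] q) :=
  Finset.prod_nonneg fun _ _ => r_nonneg hp _

theorem prod_r_le_pow {p : ℝ} (hp : 0 ≤ p) (hp' : p ≤ 1 / 2) (q : ℝ) (n : ℕ) :
    ∏ j ∈ Finset.range n, r p ((f1 p)^[j] q) ≤ (1 - p) ^ n := by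
  simpa using Finset.prod_le_prod (s := Finset.range n) (g := fun _ => 1 - p)
    (fun j _ => r_nonneg hp ((f1 p)^[j] q)) fun _ _ => r_le_one_sub hp' _

theorem summable_prod_r {p : ℝ} (hp : 0 < p) (hp' : p ≤ 1 / 2) (q : ℝ) :
    Summable fun n : ℕ => ∏ j ∈ Finset.range n, r p ((f1 p)^[j] q) :=
  (summable_geometric_of_lt_one (by linarith) (by linarith)).of_nonneg_of_le
    (prod_r_nonneg hp.le q) (prod_r_le_pow hp.le hp' q)

theorem E1star_nonneg {p : ℝ} (hp : 0 ≤ p) (q : ℝ) : 0 ≤ E1star p q :=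
  tsum_nonneg (prod_r_nonneg hp q)

theorem E1star_le {p : ℝ} (hp : 0 < p) (hp' : p ≤ 1 / 2) (q : ℝ) : E1star p q ≤ 1 / p := by
  have h0 : 0 ≤ 1 - p := by linarith
  have h1 : 1 - p < 1 := by linarith
  calc E1star p q ≤ ∑' n : ℕ, (1 - p) ^ n :=
        (summable_prod_r hp hp' q).tsum_le_tsum (prod_r_le_pow hp.le hp' q)
          (summable_geometric_of_lt_one h0 h1)
    _ = 1 / p := by rw [tsum_geometric_of_lt_one h0 h1, sub_sub_cancel, one_div]

theorem E1star_eq {p : ℝ} (hp : 0 < p) (hp' : p ≤ 1 / 2) (q : ℝ) :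
    E1star p q = 1 + r p q * E1star p (f1 p q) := by
  rw [E1star, (summable_prod_r hp hp' q).tsum_eq_zero_add, E1star, ← tsum_mul_left]
  simp [Finset.prod_range_succ', mul_comm]

/-- the series defining `E₁*` converges, `E₁*` is bounded by `1/p` on
`[0,1]`, and `E₁*` satisfies the recurrence `E₁*(q) = 1 + r(q)·E₁*(f₁(q))`. -/
theorem E1star_summable_bounded_recurrence (p : ℝ) (hp : 0 < p) (hp' : p ≤ 1 / 2) :
    ∀ q ∈ Set.Icc (0:ℝ) 1,
      Summable (fun n : ℕ => ∏ j ∈ Finset.range n, r p ((f1 p)^[j] q)) ∧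
      |E1star p q| ≤ 1 / p ∧
      E1star p q = 1 + r p q * E1star p (f1 p q) := by
  intro q _
  refine ⟨summable_prod_r hp hp' q, ?_, E1star_eq hp hp' q⟩
  rw [abs_of_nonneg (E1star_nonneg hp.le q)]
  exact E1star_le hp hp' q
end
end

section
/- Let p be a real number with 0 < p ≤ 1/2 and let f₁ : [0,1] → [0,1] be defined by f₁(q) = q/p if q ≤ p; (q − p)/(1 − p) if p < q < 1 − p; (q − (1 − p))/p if q ≥ 1 − p. If q ∈ [0,1] and k ≥ 1 satisfy f₁^k(q) = q, then q lies in the subfield ℚ(p) of ℝ generated by p over the rationals. Since ℚ(p) is countable, there exist uncountably many q ∈ [0,1] that are not periodic points of f₁. -/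
noncomputable section

lemma f1_eq_affine {p : ℝ} (hp : 0 < p) (hp' : p ≤ 1 / 2) (q : ℝ) :
    ∃ a ∈ Subfield.closure {p}, ∃ b ∈ Subfield.closure {p}, 1 < a ∧ f1 p q = a * q + b := by
  have hpK : p ∈ Subfield.closure {p} := Subfield.subset_closure rfl
  have hpK' : 1 - p ∈ Subfield.closure {p} := sub_mem (one_mem _) hpK
  have hinv : 1 < p⁻¹ := one_lt_inv₀ hp |>.2 (by linarith)
  have hinv' : 1 < (1 - p)⁻¹ := one_lt_inv₀ (by linarith) |>.2 (by linarith)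
  unfold f1
  split_ifs
  · exact ⟨p⁻¹, inv_mem hpK, 0, zero_mem _, hinv, by ring⟩
  · exact ⟨(1 - p)⁻¹, inv_mem hpK', -(p / (1 - p)), neg_mem (div_mem hpK hpK'), hinv', by ring⟩
  · exact ⟨p⁻¹, inv_mem hpK, -((1 - p) / p), neg_mem (div_mem hpK' hpK), hinv, by ring⟩

lemma iterate_f1_eq_affine {p : ℝ} (hp : 0 < p) (hp' : p ≤ 1 / 2) (q : ℝ) {k : ℕ} (hk : 1 ≤ k) :
    ∃ a ∈ Subfield.closure {p}, ∃ b ∈ Subfield.closure {p},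
      1 < a ∧ (f1 p)^[k] q = a * q + b := by
  induction k, hk using Nat.le_induction with
  | base => simpa using f1_eq_affine hp hp' q
  | succ k _ ih =>
    obtain ⟨a, ha, b, hb, ha1, hab⟩ := ih
    obtain ⟨c, hc, d, hd, hc1, hcd⟩ := f1_eq_affine hp hp' ((f1 p)^[k] q)
    refine ⟨c * a, mul_mem hc ha, c * b + d, add_mem (mul_mem hc hb) hd,
      one_lt_mul_of_lt_of_le hc1 ha1.le, ?_⟩
    rw [Function.iterate_succ_apply', hcd, hab]
    ring

lemma mem_closure_of_iterate_f1_eq {p q : ℝ} (hp : 0 < p) (hp' : p ≤ 1 / 2) {k : ℕ} (hk : 1 ≤ k)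
    (hq : (f1 p)^[k] q = q) : q ∈ Subfield.closure {p} := by
  obtain ⟨a, ha, b, hb, ha1, hab⟩ := iterate_f1_eq_affine hp hp' q hk
  have hne : 1 - a ≠ 0 := by linarith
  have hqe : q = b / (1 - a) := by
    rw [eq_div_iff hne]
    linarith
  rw [hqe]
  exact div_mem hb (sub_mem (one_mem _) ha)

lemma countable_subfield_closure {K : Type*} [Field K] {s : Set K} (hs : s.Countable) :
    (Subfield.closure s : Set K).Countable := by
  rw [← Cardinal.le_aleph0_iff_set_countable] at hs ⊢
  exact (Subfield.cardinalMk_closure_le_max s).trans (max_le hs le_rfl)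

/-- every periodic point of `f₁` in `[0,1]` lies in `ℚ(p)`, the
smallest subfield of `ℝ` containing `p`; since `ℚ(p)` is countable, the set of
non-periodic points of `[0,1]` is uncountable. -/
theorem periodic_points_mem_rational_field (p : ℝ) (hp : 0 < p) (hp' : p ≤ 1 / 2) :
    (∀ q ∈ Set.Icc (0:ℝ) 1, ∀ k : ℕ, 1 ≤ k → (f1 p)^[k] q = q →
      q ∈ Subfield.closure {p}) ∧
    (Subfield.closure {p} : Set ℝ).Countable ∧
    ¬ Set.Countable {q ∈ Set.Icc (0:ℝ) 1 | ¬ ∃ k : ℕ, 1 ≤ k ∧ (f1 p)^[k] q = q} := by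
  have hK := countable_subfield_closure (Set.countable_singleton p)
  refine ⟨fun q _ k hk hq => mem_closure_of_iterate_f1_eq hp hp' hk hq, hK, fun hN => ?_⟩
  refine (Cardinal.Real.Icc_countable_iff.not.2 (by norm_num : ¬ (1 : ℝ) ≤ 0))
    ((hN.union hK).mono fun q hq => ?_)
  by_cases h : ∃ k : ℕ, 1 ≤ k ∧ (f1 p)^[k] q = q
  · obtain ⟨k, hk, hkq⟩ := h
    exact Or.inr (mem_closure_of_iterate_f1_eq hp hp' hk hkq)
  · exact Or.inl ⟨hq, h⟩
end
end

section
/- Let p be a real number with 0 < p ≤ 1/2 and let f₁ : [0,1] → [0,1] be defined by f₁(q) = q/p if q ≤ p; (q − p)/(1 − p) if p < q < 1 − p; (q − (1 − p))/p if q ≥ 1 − p. If q₁, q₂ ∈ [0,1] satisfy f₁^{k₁}(q₁) = f₁^{k₂}(q₂) for some natural numbers k₁, k₂ (i.e., q₁ and q₂ lie in the same undirected connected component of the functional graph of f₁), then ℚ(p, q₁) = ℚ(p, q₂). -/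
noncomputable section

theorem f1_mem_iff (K : Subfield ℝ) {p : ℝ} (hp : p ≠ 0) (hp1 : 1 - p ≠ 0) (hpK : p ∈ K)
    (q : ℝ) : f1 p q ∈ K ↔ q ∈ K := by
  have h1 : 1 - p ∈ K := sub_mem (one_mem K) hpK
  unfold f1
  split_ifs
  · exact ⟨fun h => by simpa [hp] using mul_mem h hpK, fun h => div_mem h hpK⟩
  · exact ⟨fun h => by simpa [hp1] using add_mem (mul_mem h h1) hpK,
      fun h => div_mem (sub_mem h hpK) h1⟩
  · refine ⟨fun h => ?_, fun h => div_mem (sub_mem h h1) hpK⟩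
    have h2 := add_mem (mul_mem h hpK) h1
    rwa [div_mul_cancel₀ _ hp, sub_add_cancel] at h2

theorem iterate_f1_mem_iff (K : Subfield ℝ) {p : ℝ} (hp : p ≠ 0) (hp1 : 1 - p ≠ 0)
    (hpK : p ∈ K) (k : ℕ) (q : ℝ) : (f1 p)^[k] q ∈ K ↔ q ∈ K := by
  induction k generalizing q with
  | zero => rfl
  | succ k ih => rw [Function.iterate_succ_apply, ih, f1_mem_iff K hp hp1 hpK]

theorem closure_pair_le_of_iterate_f1_eq {p q₁ q₂ : ℝ} (hp : p ≠ 0) (hp1 : 1 - p ≠ 0)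
    {k₁ k₂ : ℕ} (h : (f1 p)^[k₁] q₁ = (f1 p)^[k₂] q₂) :
    Subfield.closure {p, q₁} ≤ Subfield.closure {p, q₂} := by
  have hpK : p ∈ Subfield.closure {p, q₂} := Subfield.subset_closure (by simp)
  have hqK : q₂ ∈ Subfield.closure {p, q₂} := Subfield.subset_closure (by simp)
  rw [Subfield.closure_le, Set.insert_subset_iff, Set.singleton_subset_iff]
  refine ⟨hpK, (iterate_f1_mem_iff _ hp hp1 hpK k₁ q₁).1 ?_⟩
  rw [h]
  exact (iterate_f1_mem_iff _ hp hp1 hpK k₂ q₂).2 hqK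

/-- if `q₁` and `q₂` lie in the same undirected connected component of
the functional graph of `f₁` (i.e. some forward iterates coincide), then
`ℚ(p, q₁) = ℚ(p, q₂)` as subfields of `ℝ`. -/
theorem same_component_same_field (p : ℝ) (hp : 0 < p) (hp' : p ≤ 1 / 2)
    (q₁ q₂ : ℝ) (hq₁ : q₁ ∈ Set.Icc (0:ℝ) 1) (hq₂ : q₂ ∈ Set.Icc (0:ℝ) 1)
    (k₁ k₂ : ℕ) (h : (f1 p)^[k₁] q₁ = (f1 p)^[k₂] q₂) :
    Subfield.closure {p, q₁} = Subfield.closure {p, q₂} := by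
  have hp0 : p ≠ 0 := hp.ne'
  have hp1 : 1 - p ≠ 0 := by linarith
  exact le_antisymm (closure_pair_le_of_iterate_f1_eq hp0 hp1 h)
    (closure_pair_le_of_iterate_f1_eq hp0 hp1 h.symm)
end
end
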